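/- Let X be a normal topological space, and let f, g : X → Y and f', g' : Y → Z be continuous maps. Then D(f' ∘ f, g' ∘ g) ≤ D(f, g) + D(f', g'). -/

import Mathlib

open ContinuousMap

/-- The homotopic distance between two continuous maps `f g : C(X, Y)`:
the least `n : ℕ∞` such that `X` admits an open cover by `n + 1` sets on each of
which the restrictions of `f` and `g` are homotopic; `⊤` if no such cover exists. -/
noncomputable def homotopicDistance {X Y : Type*} [TopologicalSpace X] [TopologicalSpace Y]
    (f g : C(X, Y)) : ℕ∞ :=
  sInf ((Nat.cast : ℕ → ℕ∞) '' {n : ℕ | ∃ U : Fin (n + 1) → Set X,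
    (∀ j, IsOpen (U j)) ∧ (⋃ j, U j) = Set.univ ∧
    ∀ j, (f.restrict (U j)).Homotopic (g.restrict (U j))})

/-- The (normalized) Lusternik–Schnirelmann category of a space `X`: the least
`n : ℕ∞` such that `X` admits an open cover by `n + 1` sets on each of which the
inclusion into `X` is null-homotopic. -/
noncomputable def lsCat (X : Type*) [TopologicalSpace X] : ℕ∞ :=
  sInf ((Nat.cast : ℕ → ℕ∞) '' {n : ℕ | ∃ U : Fin (n + 1) → Set X,
    (∀ j, IsOpen (U j)) ∧ (⋃ j, U j) = Set.univ ∧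
    ∀ j, ∃ y : X, ((ContinuousMap.id X).restrict (U j)).Homotopic
      (ContinuousMap.const (U j) y)})

section

variable {X Y : Type*} [TopologicalSpace X] [TopologicalSpace Y]

lemma homotopicDistance_le_coe {f g : C(X, Y)} {n : ℕ} (U : Fin (n + 1) → Set X)
    (hU : ∀ j, IsOpen (U j)) (hcov : (⋃ j, U j) = Set.univ)
    (h : ∀ j, (f.restrict (U j)).Homotopic (g.restrict (U j))) :
    homotopicDistance f g ≤ n :=
  sInf_le ⟨n, ⟨U, hU, hcov, h⟩, rfl⟩

lemma exists_cover_of_homotopicDistance_ne_top {f g : C(X, Y)} (h : homotopicDistance f g ≠ ⊤) :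
    ∃ n : ℕ, homotopicDistance f g = n ∧ ∃ U : Fin (n + 1) → Set X,
      (∀ j, IsOpen (U j)) ∧ (⋃ j, U j) = Set.univ ∧
      ∀ j, (f.restrict (U j)).Homotopic (g.restrict (U j)) := by
  unfold homotopicDistance at h ⊢
  generalize hs : (Nat.cast : ℕ → ℕ∞) '' _ = s at h ⊢
  have hmem : sInf s ∈ s :=
    csInf_mem (Set.nonempty_iff_ne_empty.2 fun he ↦ h (by rw [he, sInf_empty]))
  obtain ⟨n, hn, hn'⟩ := hs.symm.subset hmem
  exact ⟨n, hn'.symm, hn⟩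

lemma ContinuousMap.Homotopic.restrict_mono {f g : C(X, Y)} {U V : Set X} (hVU : V ⊆ U)
    (h : (f.restrict U).Homotopic (g.restrict U)) :
    (f.restrict V).Homotopic (g.restrict V) :=
  h.comp (Homotopic.refl (⟨Set.inclusion hVU, continuous_inclusion hVU⟩ : C(V, U)))

/-- Homotopies on pairwise disjoint open sets glue to a homotopy on their union. -/
lemma ContinuousMap.Homotopic.restrict_iUnion {f g : C(X, Y)} {ι : Type*} {U : ι → Set X}
    (hU : ∀ i, IsOpen (U i)) (hd : Pairwise (Function.onFun Disjoint U))
    (h : ∀ i, (f.restrict (U i)).Homotopic (g.restrict (U i))) :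
    (f.restrict (⋃ i, U i)).Homotopic (g.restrict (⋃ i, U i)) := by
  have H : ∀ i, (f.restrict (U i)).Homotopy (g.restrict (U i)) := fun i ↦ (h i).some
  let S : ι → Set (unitInterval × ↥(⋃ i, U i)) := fun i ↦ {p | (p.2 : X) ∈ U i}
  let φ : ∀ i, C(S i, Y) := fun i ↦
    ⟨fun p ↦ H i (p.1.1, ⟨p.1.2, p.2⟩), by fun_prop⟩
  have hφ : ∀ (i j) (p : unitInterval × ↥(⋃ i, U i)) (hi : p ∈ S i) (hj : p ∈ S j),
      φ i ⟨p, hi⟩ = φ j ⟨p, hj⟩ := by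
    intro i j p hi hj
    obtain rfl : i = j := by
      by_contra hij
      exact Set.disjoint_left.1 (hd hij) hi hj
    rfl
  have hS : ∀ p, ∃ i, S i ∈ nhds p := by
    rintro ⟨t, x, hx⟩
    obtain ⟨i, hi⟩ := Set.mem_iUnion.1 hx
    have : IsOpen (S i) := (hU i).preimage (continuous_subtype_val.comp continuous_snd)
    exact ⟨i, this.mem_nhds hi⟩
  have key : ∀ i (p : unitInterval × ↥(⋃ i, U i)) (hp : (p.2 : X) ∈ U i),
      liftCover S φ hφ hS p = H i (p.1, ⟨p.2, hp⟩) := fun i p hp ↦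
    liftCover_coe (S := S) (φ := φ) (hφ := hφ) (hS := hS) (i := i) ⟨p, hp⟩
  refine ⟨⟨liftCover S φ hφ hS, ?_, ?_⟩⟩
  · rintro ⟨x, hx⟩
    obtain ⟨i, hi⟩ := Set.mem_iUnion.1 hx
    exact (key i (0, ⟨x, hx⟩) hi).trans ((H i).apply_zero _)
  · rintro ⟨x, hx⟩
    obtain ⟨i, hi⟩ := Set.mem_iUnion.1 hx
    exact (key i (1, ⟨x, hx⟩) hi).trans ((H i).apply_one _)

end

section

variable {X : Type*} [TopologicalSpace X] [NormalSpace X]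

/-- In a normal space, finitely many pairwise disjoint closed sets have pairwise disjoint open
neighbourhoods. -/
lemma exists_pairwise_disjoint_isOpen {ι : Type*} [Finite ι] {F : ι → Set X}
    (hF : ∀ i, IsClosed (F i)) (hd : Pairwise (Function.onFun Disjoint F)) :
    ∃ G : ι → Set X, (∀ i, IsOpen (G i)) ∧ (∀ i, F i ⊆ G i) ∧
      Pairwise (Function.onFun Disjoint G) := by
  have h : Pairwise (Function.onFun Disjoint fun i ↦ nhdsSet (F i)) := fun i j hij ↦
    separatedNhds_iff_disjoint.1 (normal_separation (hF i) (hF j) (hd hij))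
  obtain ⟨t, ht, htd⟩ := h.exists_mem_filter_of_disjoint
  refine ⟨fun i ↦ interior (t i), fun i ↦ isOpen_interior,
    fun i ↦ subset_interior_iff_mem_nhdsSet.2 (ht i), fun i j hij ↦ ?_⟩
  exact (htd hij).mono interior_subset interior_subset

open Classical in
/-- If every point lies in at least `r + 1` members of a finite open family `U`, then the points
lying in exactly `r + 1` members are covered by a single disjoint union of open sets, each
contained in a member of `U`. -/
lemma exists_isOpen_forall_mem_or_lt_card {P : Set X → Prop}
    (mono : ∀ U V, V ⊆ U → P U → P V)
    (glue : ∀ {κ : Type} (U : κ → Set X), (∀ i, IsOpen (U i)) →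
      Pairwise (Function.onFun Disjoint U) → (∀ i, P (U i)) → P (⋃ i, U i))
    {ι : Type} [Fintype ι] {U : ι → Set X} (hU : ∀ i, IsOpen (U i)) (hP : ∀ i, P (U i)) {r : ℕ}
    (hr : ∀ x, r + 1 ≤ (Finset.univ.filter fun i ↦ x ∈ U i).card) :
    ∃ V, IsOpen V ∧ P V ∧
      ∀ x, x ∈ V ∨ r + 2 ≤ (Finset.univ.filter fun i ↦ x ∈ U i).card := by
  let A : X → Finset ι := fun x ↦ Finset.univ.filter fun i ↦ x ∈ U i
  let κ := {S : Finset ι // S.card = r + 1}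
  let F : κ → Set X := fun S ↦ ⋂ i : {i // i ∉ S.1}, (U i)ᶜ
  have hFA : ∀ S x, x ∈ F S → A x = S.1 := by
    intro S x hx
    refine Finset.eq_of_subset_of_card_le (fun i hi ↦ ?_) (S.2.trans_le (hr x))
    by_contra hiS
    exact Set.mem_iInter.1 hx ⟨i, hiS⟩ (Finset.mem_filter.1 hi).2
  have hF : ∀ S, IsClosed (F S) := fun S ↦ isClosed_iInter fun i ↦ (hU i).isClosed_compl
  have hd : Pairwise (Function.onFun Disjoint F) := fun S T hST ↦
    Set.disjoint_left.2 fun x hS hT ↦ hST (Subtype.ext ((hFA S x hS).symm.trans (hFA T x hT)))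
  obtain ⟨G, hG, hFG, hGd⟩ := exists_pairwise_disjoint_isOpen hF hd
  have hne : ∀ S : κ, S.1.Nonempty := fun S ↦ Finset.card_pos.1 (by rw [S.2]; omega)
  choose c hc using hne
  refine ⟨⋃ S, G S ∩ U (c S), isOpen_iUnion fun S ↦ (hG S).inter (hU _),
    glue _ (fun S ↦ (hG S).inter (hU _))
      (fun S T hST ↦ (hGd hST).mono Set.inter_subset_left Set.inter_subset_left)
      fun S ↦ mono _ _ Set.inter_subset_right (hP _), fun x ↦ ?_⟩
  refine or_iff_not_imp_right.2 fun hx ↦ ?_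
  have hx' : (A x).card = r + 1 := le_antisymm (Nat.lt_succ_iff.1 (not_le.1 hx)) (hr x)
  let S : κ := ⟨A x, hx'⟩
  refine Set.mem_iUnion.2 ⟨S, hFG S ?_, (Finset.mem_filter.1 (hc S)).2⟩
  refine Set.mem_iInter.2 fun i hi ↦ i.2 (Finset.mem_filter.2 ⟨Finset.mem_univ _, hi⟩)

open Classical in
/-- An open cover of a normal space by `m + 1` sets with a property that passes to subsets and
to disjoint unions of open sets gives rise to an open family of `m + r + 1` sets with that
property such that every point lies in at least `r + 1` of them. -/
lemma exists_isOpen_family_forall_lt_card {P : Set X → Prop}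
    (mono : ∀ U V, V ⊆ U → P U → P V)
    (glue : ∀ {κ : Type} (U : κ → Set X), (∀ i, IsOpen (U i)) →
      Pairwise (Function.onFun Disjoint U) → (∀ i, P (U i)) → P (⋃ i, U i))
    {m : ℕ} {U : Fin (m + 1) → Set X} (hU : ∀ i, IsOpen (U i)) (hcov : (⋃ i, U i) = Set.univ)
    (hP : ∀ i, P (U i)) (r : ℕ) :
    ∃ V : Fin (m + r + 1) → Set X, (∀ i, IsOpen (V i)) ∧ (∀ i, P (V i)) ∧
      ∀ x, r + 1 ≤ (Finset.univ.filter fun i ↦ x ∈ V i).card := by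
  induction r with
  | zero =>
    refine ⟨U, hU, hP, fun x ↦ Finset.card_pos.2 ?_⟩
    obtain ⟨i, hi⟩ := Set.mem_iUnion.1 (hcov ▸ Set.mem_univ x)
    exact ⟨i, by simpa using hi⟩
  | succ r ih =>
    obtain ⟨V, hV, hPV, hr⟩ := ih
    obtain ⟨W, hW, hPW, hVW⟩ := exists_isOpen_forall_mem_or_lt_card mono glue hV hPV hr
    refine ⟨(Fin.cons W V : Fin (m + r + 1 + 1) → Set X), Fin.cases hW hV, Fin.cases hPW hPV,
      fun x ↦ ?_⟩
    have hcard : (Finset.univ.filter fun i ↦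
        x ∈ (Fin.cons W V : Fin (m + r + 1 + 1) → Set X) i).card =
        (if x ∈ W then 1 else 0) + (Finset.univ.filter fun i ↦ x ∈ V i).card := by
      rw [Fin.card_filter_univ_succ']
      rfl
    refine le_of_le_of_eq ?_ hcard.symm
    have := hr x
    rcases hVW x with h | h
    · rw [if_pos h]
      omega
    · omega

/-- Two open covers of a normal space by `m + 1` and `n + 1` sets, with properties that pass to
subsets and to disjoint unions of open sets, have a common open cover by `m + n + 1` sets with
both properties. -/
lemma exists_common_open_cover {P Q : Set X → Prop}
    (monoP : ∀ U V, V ⊆ U → P U → P V)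
    (glueP : ∀ {κ : Type} (U : κ → Set X), (∀ i, IsOpen (U i)) →
      Pairwise (Function.onFun Disjoint U) → (∀ i, P (U i)) → P (⋃ i, U i))
    (monoQ : ∀ U V, V ⊆ U → Q U → Q V)
    (glueQ : ∀ {κ : Type} (U : κ → Set X), (∀ i, IsOpen (U i)) →
      Pairwise (Function.onFun Disjoint U) → (∀ i, Q (U i)) → Q (⋃ i, U i))
    {m n : ℕ} {U : Fin (m + 1) → Set X} (hU : ∀ i, IsOpen (U i))
    (hUcov : (⋃ i, U i) = Set.univ) (hP : ∀ i, P (U i))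
    {W : Fin (n + 1) → Set X} (hW : ∀ i, IsOpen (W i))
    (hWcov : (⋃ i, W i) = Set.univ) (hQ : ∀ i, Q (W i)) :
    ∃ V : Fin (m + n + 1) → Set X, (∀ i, IsOpen (V i)) ∧ (⋃ i, V i) = Set.univ ∧
      ∀ i, P (V i) ∧ Q (V i) := by
  classical
  obtain ⟨A, hA, hPA, hcA⟩ := exists_isOpen_family_forall_lt_card monoP glueP hU hUcov hP n
  obtain ⟨B, hB, hQB, hcB⟩ := exists_isOpen_family_forall_lt_card monoQ glueQ hW hWcov hQ m
  let e : Fin (m + n + 1) ≃ Fin (n + m + 1) := finCongr (by omega)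
  refine ⟨fun i ↦ A i ∩ B (e i), fun i ↦ (hA i).inter (hB _), Set.eq_univ_of_forall fun x ↦ ?_,
    fun i ↦ ⟨monoP _ _ Set.inter_subset_left (hPA i), monoQ _ _ Set.inter_subset_right (hQB _)⟩⟩
  have hcB' : (Finset.univ.filter fun i ↦ x ∈ B (e i)).card =
      (Finset.univ.filter fun i ↦ x ∈ B i).card :=
    Finset.card_equiv e (by simp)
  have hlt : (Finset.univ : Finset (Fin (m + n + 1))).card <
      (Finset.univ.filter fun i ↦ x ∈ A i).card +
        (Finset.univ.filter fun i ↦ x ∈ B (e i)).card := by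
    have := hcA x
    have := hcB x
    rw [hcB', Finset.card_univ, Fintype.card_fin]
    omega
  obtain ⟨i, hi⟩ := Finset.inter_nonempty_of_card_lt_card_add_card
    (Finset.subset_univ _) (Finset.subset_univ _) hlt
  simp only [Finset.mem_inter, Finset.mem_filter, Finset.mem_univ, true_and] at hi
  exact Set.mem_iUnion.2 ⟨i, hi⟩

end

/-- for a normal domain, `D(f' ∘ f, g' ∘ g) ≤ D(f, g) + D(f', g')`. -/
theorem homotopicDistance_comp_le_add {X Y Z : Type*} [TopologicalSpace X] [NormalSpace X]
    [TopologicalSpace Y] [TopologicalSpace Z] (f g : C(X, Y)) (f' g' : C(Y, Z)) :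
    homotopicDistance (f'.comp f) (g'.comp g) ≤
      homotopicDistance f g + homotopicDistance f' g' := by
  by_cases h : homotopicDistance f g = ⊤
  · simp [h]
  by_cases h' : homotopicDistance f' g' = ⊤
  · simp [h']
  obtain ⟨m, hm, U, hU, hUcov, hUh⟩ := exists_cover_of_homotopicDistance_ne_top h
  obtain ⟨n, hn, W, hW, hWcov, hWh⟩ := exists_cover_of_homotopicDistance_ne_top h'
  obtain ⟨V, hV, hVcov, hVh⟩ := exists_common_open_cover
    (P := fun S ↦ ((f'.comp f).restrict S).Homotopic ((f'.comp g).restrict S))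
    (Q := fun S ↦ ((f'.comp g).restrict S).Homotopic ((g'.comp g).restrict S))
    (fun _ _ hVU ↦ Homotopic.restrict_mono hVU) (fun _ ↦ Homotopic.restrict_iUnion)
    (fun _ _ hVU ↦ Homotopic.restrict_mono hVU) (fun _ ↦ Homotopic.restrict_iUnion)
    hU hUcov (fun j ↦ (Homotopic.refl f').comp (hUh j))
    (W := fun j ↦ g ⁻¹' W j) (fun j ↦ (hW j).preimage g.continuous)
    (by rw [← Set.preimage_iUnion, hWcov, Set.preimage_univ])
    (fun j ↦ (hWh j).comp (Homotopic.refl (g.restrictPreimage (W j))))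
  rw [hm, hn, ← Nat.cast_add]
  exact homotopicDistance_le_coe V hV hVcov fun j ↦ (hVh j).1.trans (hVh j).2
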